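/- Let m ∈ ℕ, R > 0, and let χ be a positive zero of the Bessel function J_m. Then the function u(r,θ) = J_m(rχ/R) cos(mθ), expressed in Cartesian coordinates on the disk of radius R, satisfies Δu + (χ/R)² u = 0 in the open disk and u = 0 on the boundary circle r = R. -/

import Mathlib

/-- The 2D Laplacian of a real-valued function on `ℝ × ℝ`. -/
noncomputable def laplacian2 (u : ℝ × ℝ → ℝ) (p : ℝ × ℝ) : ℝ :=
  fderiv ℝ (fun q => fderiv ℝ u q ((1 : ℝ), (0 : ℝ))) p ((1 : ℝ), (0 : ℝ))
    + fderiv ℝ (fun q => fderiv ℝ u q ((0 : ℝ), (1 : ℝ))) p ((0 : ℝ), (1 : ℝ))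

/-- The linear functional `(y, z) ↦ a y + b z` on the plane. -/
noncomputable def planeCovector (a b : ℝ) : ℝ × ℝ →L[ℝ] ℝ :=
  a • ContinuousLinearMap.fst ℝ ℝ ℝ + b • ContinuousLinearMap.snd ℝ ℝ ℝ

@[simp] lemma planeCovector_apply (a b : ℝ) (q : ℝ × ℝ) :
    planeCovector a b q = a * q.1 + b * q.2 := by
  simp [planeCovector]

/-- The function `f` has partial derivatives `a`, `b` at `p`, and is differentiable there. -/
def HasPartials (f : ℝ × ℝ → ℝ) (a b : ℝ) (p : ℝ × ℝ) : Prop :=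
  HasFDerivAt f (planeCovector a b) p

namespace HasPartials

variable {f g : ℝ × ℝ → ℝ} {a b c d : ℝ} {p : ℝ × ℝ}

lemma congr_partials (h : HasPartials f a b p) (ha : a = c) (hb : b = d) :
    HasPartials f c d p := ha ▸ hb ▸ h

lemma mul (hf : HasPartials f a b p) (hg : HasPartials g c d p) :
    HasPartials (fun q => f q * g q) (a * g p + f p * c) (b * g p + f p * d) p := by
  have h := HasFDerivAt.mul hf hg
  refine h.congr_fderiv ?_
  ext <;> simp <;> ring

lemma add (hf : HasPartials f a b p) (hg : HasPartials g c d p) :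
    HasPartials (fun q => f q + g q) (a + c) (b + d) p := by
  have h := HasFDerivAt.add hf hg
  refine h.congr_fderiv ?_
  ext <;> simp

lemma sub (hf : HasPartials f a b p) (hg : HasPartials g c d p) :
    HasPartials (fun q => f q - g q) (a - c) (b - d) p := by
  have h := HasFDerivAt.sub hf hg
  refine h.congr_fderiv ?_
  ext <;> simp

lemma const_mul (k : ℝ) (hf : HasPartials f a b p) :
    HasPartials (fun q => k * f q) (k * a) (k * b) p := by
  have h := HasFDerivAt.const_mul hf k
  refine h.congr_fderiv ?_
  ext <;> simp

lemma comp {φ : ℝ → ℝ} {φ' : ℝ} (hφ : HasDerivAt φ φ' (f p)) (hf : HasPartials f a b p) :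
    HasPartials (fun q => φ (f q)) (φ' * a) (φ' * b) p := by
  have h := hφ.comp_hasFDerivAt p hf
  refine h.congr_fderiv ?_
  ext <;> simp

lemma div (hf : HasPartials f a b p) (hg : HasPartials g c d p) (h0 : g p ≠ 0) :
    HasPartials (fun q => f q / g q) ((a * g p - f p * c) / g p ^ 2)
      ((b * g p - f p * d) / g p ^ 2) p := by
  have h := hf.mul (comp (hasDerivAt_inv h0) hg)
  refine h.congr_partials ?_ ?_ <;> field_simp <;> ring

lemma congr_eventuallyEq (hf : HasPartials f a b p) (h : g =ᶠ[nhds p] f) :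
    HasPartials g a b p :=
  HasFDerivAt.congr_of_eventuallyEq hf h

lemma fderiv_fst (hf : HasPartials f a b p) : fderiv ℝ f p ((1 : ℝ), (0 : ℝ)) = a := by
  rw [HasFDerivAt.fderiv hf]; simp

lemma fderiv_snd (hf : HasPartials f a b p) : fderiv ℝ f p ((0 : ℝ), (1 : ℝ)) = b := by
  rw [HasFDerivAt.fderiv hf]; simp

end HasPartials

lemma hasPartials_fst (p : ℝ × ℝ) : HasPartials (fun q => q.1) 1 0 p := by
  refine (hasFDerivAt_fst (𝕜 := ℝ)).congr_fderiv ?_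
  ext <;> simp

lemma hasPartials_snd (p : ℝ × ℝ) : HasPartials (fun q => q.2) 0 1 p := by
  refine (hasFDerivAt_snd (𝕜 := ℝ)).congr_fderiv ?_
  ext <;> simp

/-- The polar radius of a point of the plane. -/
noncomputable def polarRadius (q : ℝ × ℝ) : ℝ := Real.sqrt (q.1 ^ 2 + q.2 ^ 2)

/-- The polar angle of a point of the plane. -/
noncomputable def polarAngle (q : ℝ × ℝ) : ℝ := Complex.arg (q.1 + q.2 * Complex.I)

lemma polarRadius_sq (q : ℝ × ℝ) : polarRadius q ^ 2 = q.1 ^ 2 + q.2 ^ 2 :=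
  Real.sq_sqrt (by positivity)

lemma polarRadius_nonneg (q : ℝ × ℝ) : 0 ≤ polarRadius q := Real.sqrt_nonneg _

lemma polarRadius_pos {q : ℝ × ℝ} (hq : q ≠ 0) : 0 < polarRadius q := by
  apply Real.sqrt_pos.2
  by_contra! h
  apply hq
  have h1 : q.1 = 0 := by nlinarith [sq_nonneg q.1, sq_nonneg q.2]
  have h2 : q.2 = 0 := by nlinarith [sq_nonneg q.1, sq_nonneg q.2]
  exact Prod.ext h1 h2

lemma polarRadius_zero : polarRadius 0 = 0 := by simp [polarRadius]

lemma polarAngle_zero : polarAngle 0 = 0 := by simp [polarAngle]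

lemma continuous_polarRadius : Continuous polarRadius := by
  unfold polarRadius; fun_prop

lemma norm_add_mul_I_eq_polarRadius (q : ℝ × ℝ) :
    ‖(q.1 + q.2 * Complex.I : ℂ)‖ = polarRadius q := by
  rw [Complex.norm_add_mul_I]; rfl

lemma cos_polarAngle {q : ℝ × ℝ} (hq : q ≠ 0) :
    Real.cos (polarAngle q) = q.1 / polarRadius q := by
  have h := norm_add_mul_I_eq_polarRadius q
  have h0 : (q.1 + q.2 * Complex.I : ℂ) ≠ 0 := by
    rw [← norm_pos_iff, h]; exact polarRadius_pos hq
  rw [polarAngle, Complex.cos_arg h0, h]; simp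

lemma sin_polarAngle (q : ℝ × ℝ) : Real.sin (polarAngle q) = q.2 / polarRadius q := by
  rw [polarAngle, Complex.sin_arg, norm_add_mul_I_eq_polarRadius]; simp

lemma hasPartials_polarRadius {p : ℝ × ℝ} (hp : p ≠ 0) :
    HasPartials polarRadius (p.1 / polarRadius p) (p.2 / polarRadius p) p := by
  have hr := polarRadius_pos hp
  have h2 := ((hasPartials_fst p).mul (hasPartials_fst p)).add
    ((hasPartials_snd p).mul (hasPartials_snd p))
  have e := polarRadius_sq p
  have h0 : p.1 * p.1 + p.2 * p.2 ≠ 0 := by nlinarith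
  have es : Real.sqrt (p.1 * p.1 + p.2 * p.2) = polarRadius p := by
    simp [polarRadius, sq]
  have h := HasPartials.comp (Real.hasDerivAt_sqrt h0) h2
  rw [es] at h
  have h' := h.congr_eventuallyEq (g := polarRadius)
    (Filter.Eventually.of_forall fun q => by simp [polarRadius, sq])
  refine h'.congr_partials ?_ ?_ <;> field_simp <;> ring

lemma hasPartials_fst_div_polarRadius {p : ℝ × ℝ} (hp : p ≠ 0) :
    HasPartials (fun q => q.1 / polarRadius q) (p.2 ^ 2 / polarRadius p ^ 3)
      (-(p.1 * p.2 / polarRadius p ^ 3)) p := by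
  have hr := polarRadius_pos hp
  have e := polarRadius_sq p
  refine ((hasPartials_fst p).div (hasPartials_polarRadius hp) hr.ne').congr_partials ?_ ?_ <;>
    field_simp <;> linarith

lemma hasPartials_snd_div_polarRadius {p : ℝ × ℝ} (hp : p ≠ 0) :
    HasPartials (fun q => q.2 / polarRadius q) (-(p.1 * p.2 / polarRadius p ^ 3))
      (p.1 ^ 2 / polarRadius p ^ 3) p := by
  have hr := polarRadius_pos hp
  have e := polarRadius_sq p
  refine ((hasPartials_snd p).div (hasPartials_polarRadius hp) hr.ne').congr_partials ?_ ?_ <;>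
    field_simp <;> linarith

lemma hasPartials_cos_sin_mul_polarAngle (m : ℕ) {p : ℝ × ℝ} (hp : p ≠ 0) :
    HasPartials (fun q => Real.cos (m * polarAngle q))
      (m * Real.sin (m * polarAngle p) * p.2 / polarRadius p ^ 2)
      (-(m * Real.sin (m * polarAngle p) * p.1 / polarRadius p ^ 2)) p ∧
    HasPartials (fun q => Real.sin (m * polarAngle q))
      (-(m * Real.cos (m * polarAngle p) * p.2 / polarRadius p ^ 2))
      (m * Real.cos (m * polarAngle p) * p.1 / polarRadius p ^ 2) p := by
  have hr := polarRadius_pos hp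
  have hne : ∀ᶠ q in nhds p, q ≠ 0 := isOpen_ne.eventually_mem hp
  induction m with
  | zero =>
    simp only [HasPartials]
    constructor
    · refine HasFDerivAt.congr_fderiv (f' := 0) (by simpa using hasFDerivAt_const _ _) ?_
      ext <;> simp
    · refine HasFDerivAt.congr_fderiv (f' := 0) (by simpa using hasFDerivAt_const _ _) ?_
      ext <;> simp
  | succ m ih =>
    obtain ⟨ihc, ihs⟩ := ih
    have hc1 := hasPartials_fst_div_polarRadius hp
    have hs1 := hasPartials_snd_div_polarRadius hp
    have hcos : ∀ q : ℝ × ℝ, q ≠ 0 → Real.cos ((m + 1 : ℕ) * polarAngle q) =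
        Real.cos (m * polarAngle q) * (q.1 / polarRadius q)
          - Real.sin (m * polarAngle q) * (q.2 / polarRadius q) := by
      intro q hq
      push_cast
      rw [add_one_mul, Real.cos_add, cos_polarAngle hq, sin_polarAngle]
    have hsin : ∀ q : ℝ × ℝ, q ≠ 0 → Real.sin ((m + 1 : ℕ) * polarAngle q) =
        Real.sin (m * polarAngle q) * (q.1 / polarRadius q)
          + Real.cos (m * polarAngle q) * (q.2 / polarRadius q) := by
      intro q hq
      push_cast
      rw [add_one_mul, Real.sin_add, cos_polarAngle hq, sin_polarAngle]
    have hc := ((ihc.mul hc1).sub (ihs.mul hs1)).congr_eventuallyEq (hne.mono hcos)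
    have hs := ((ihs.mul hc1).add (ihc.mul hs1)).congr_eventuallyEq (hne.mono hsin)
    rw [hcos p hp, hsin p hp]
    refine ⟨hc.congr_partials ?_ ?_, hs.congr_partials ?_ ?_⟩ <;>
      push_cast <;> field_simp <;> ring

lemma hasPartials_radial_mul_cos {f : ℝ → ℝ} {f' : ℝ} (m : ℕ) {p : ℝ × ℝ} (hp : p ≠ 0)
    (hf : HasDerivAt f f' (polarRadius p)) :
    HasPartials (fun q => f (polarRadius q) * Real.cos (m * polarAngle q))
      (f' * (p.1 / polarRadius p) * Real.cos (m * polarAngle p)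
        + m * (f (polarRadius p) * (p.2 / polarRadius p ^ 2)) * Real.sin (m * polarAngle p))
      (f' * (p.2 / polarRadius p) * Real.cos (m * polarAngle p)
        - m * (f (polarRadius p) * (p.1 / polarRadius p ^ 2)) * Real.sin (m * polarAngle p)) p := by
  have h := (HasPartials.comp hf (hasPartials_polarRadius hp)).mul
    (hasPartials_cos_sin_mul_polarAngle m hp).1
  refine h.congr_partials ?_ ?_ <;> ring

lemma laplacian2_of_hasPartials {u g₁ g₂ : ℝ × ℝ → ℝ} {p : ℝ × ℝ} {a b c d : ℝ}
    (hu : ∀ᶠ q in nhds p, HasPartials u (g₁ q) (g₂ q) q)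
    (h₁ : HasPartials g₁ a b p) (h₂ : HasPartials g₂ c d p) :
    laplacian2 u p = a + d := by
  have e₁ : (fun q => fderiv ℝ u q ((1 : ℝ), (0 : ℝ))) =ᶠ[nhds p] g₁ :=
    hu.mono fun q hq => hq.fderiv_fst
  have e₂ : (fun q => fderiv ℝ u q ((0 : ℝ), (1 : ℝ))) =ᶠ[nhds p] g₂ :=
    hu.mono fun q hq => hq.fderiv_snd
  rw [laplacian2, (h₁.congr_eventuallyEq e₁).fderiv_fst, (h₂.congr_eventuallyEq e₂).fderiv_snd]

lemma laplacian2_radial_mul_cos {f f' f'' : ℝ → ℝ} (m : ℕ) (hf : ∀ r, HasDerivAt f (f' r) r)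
    (hf' : ∀ r, HasDerivAt f' (f'' r) r) {p : ℝ × ℝ} (hp : p ≠ 0) :
    laplacian2 (fun q => f (polarRadius q) * Real.cos (m * polarAngle q)) p =
      (f'' (polarRadius p) + f' (polarRadius p) / polarRadius p
        - m ^ 2 / polarRadius p ^ 2 * f (polarRadius p)) * Real.cos (m * polarAngle p) := by
  have hr := polarRadius_pos hp
  have e := polarRadius_sq p
  have hne : ∀ᶠ q in nhds p, q ≠ 0 := isOpen_ne.eventually_mem hp
  have hu := hne.mono fun q hq => hasPartials_radial_mul_cos m hq (hf (polarRadius q))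
  have hρ := hasPartials_polarRadius hp
  obtain ⟨hc, hs⟩ := hasPartials_cos_sin_mul_polarAngle m hp
  have hy := hasPartials_fst_div_polarRadius hp
  have hz := hasPartials_snd_div_polarRadius hp
  have hF := HasPartials.comp (hf _) hρ
  have hF' := HasPartials.comp (hf' _) hρ
  have hρ2 := HasPartials.comp (hasDerivAt_pow 2 (polarRadius p)) hρ
  have hy2 := (hasPartials_fst p).div hρ2 (by positivity)
  have hz2 := (hasPartials_snd p).div hρ2 (by positivity)
  have h₁ := ((hF'.mul hy).mul hc).add (((hF.mul hz2).const_mul m).mul hs)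
  have h₂ := ((hF'.mul hz).mul hc).sub (((hF.mul hy2).const_mul m).mul hs)
  rw [laplacian2_of_hasPartials hu h₁ h₂]
  linear_combination (norm := (push_cast; field_simp; ring))
    -((f'' (polarRadius p) + f' (polarRadius p) / polarRadius p
      - m ^ 2 / polarRadius p ^ 2 * f (polarRadius p)) * Real.cos (m * polarAngle p)
        / polarRadius p ^ 2) * e

section Origin

open Asymptotics Filter Topology

lemma hasDerivAt_taylor_isLittleO {f f' : ℝ → ℝ} {a : ℝ} (hf : ∀ r, HasDerivAt f (f' r) r)
    (hf' : HasDerivAt f' a 0) :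
    (fun r => f' r - f' 0 - a * r) =o[𝓝 0] (fun r : ℝ => r) ∧
    (fun r => f r - f 0 - f' 0 * r - a / 2 * r ^ 2) =o[𝓝 0] (fun r : ℝ => r ^ 2) := by
  have h1 : (fun r => f' r - f' 0 - a * r) =o[𝓝 0] (fun r : ℝ => r) := by
    have := hf'.isLittleO
    simpa [mul_comm a] using this
  refine ⟨h1, ?_⟩
  rw [isLittleO_iff] at h1 ⊢
  intro c hc
  obtain ⟨δ, hδ, h⟩ := Metric.eventually_nhds_iff.1 (h1 hc)
  refine Metric.eventually_nhds_iff.2 ⟨δ, hδ, fun r hr => ?_⟩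
  have hd : ∀ x ∈ Metric.closedBall (0 : ℝ) |r|,
      HasDerivWithinAt (fun r => f r - f 0 - f' 0 * r - a / 2 * r ^ 2) (f' x - f' 0 - a * x)
        (Metric.closedBall (0 : ℝ) |r|) x := by
    intro x _
    have := ((((hf x).sub_const (f 0)).sub ((hasDerivAt_id x).const_mul (f' 0))).sub
      ((hasDerivAt_pow 2 x).const_mul (a / 2)))
    refine (this.congr_deriv ?_).hasDerivWithinAt
    push_cast; ring
  have hb : ∀ x ∈ Metric.closedBall (0 : ℝ) |r|, ‖f' x - f' 0 - a * x‖ ≤ c * |r| := by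
    intro x hx
    have hx' : |x| ≤ |r| := by simpa using hx
    have hr' : |r| < δ := by simpa using hr
    have := h (y := x) (by simpa using hx'.trans_lt hr')
    exact this.trans (by rw [Real.norm_eq_abs]; gcongr)
  have := (convex_closedBall (0 : ℝ) |r|).norm_image_sub_le_of_norm_hasDerivWithin_le hd hb
    (x := 0) (y := r) (by simp) (by simp)
  simp only [norm_pow, Real.norm_eq_abs] at this ⊢
  simp only [sub_self, mul_zero, sub_zero, zero_pow two_ne_zero] at this
  calc _ ≤ _ := this
    _ = _ := by ring

lemma quadratic_coeffs_eq_zero_of_isLittleO {a b c : ℝ}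
    (h : (fun r : ℝ => a + b * r + c * r ^ 2) =o[𝓝 0] (fun r : ℝ => r ^ 2)) :
    a = 0 ∧ b = 0 ∧ c = 0 := by
  have key : ∀ {g : ℝ → ℝ} {n : ℕ}, Continuous g →
      (fun r : ℝ => r ^ n * g r) =o[𝓝 0] (fun r : ℝ => r ^ n) → g 0 = 0 := by
    intro g n hg hl
    have hl' := hl.mono (nhdsWithin_le_nhds (s := {0}ᶜ))
    have ht := hl'.tendsto_div_nhds_zero
    have ht2 : Tendsto g (𝓝[≠] 0) (𝓝 0) := by
      refine ht.congr' ?_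
      filter_upwards [self_mem_nhdsWithin] with r hr
      have : r ≠ 0 := hr
      field_simp
    exact tendsto_nhds_unique ((hg.tendsto 0).mono_left nhdsWithin_le_nhds) ht2
  have hpow : ∀ n : ℕ, n ≤ 2 → (fun r : ℝ => r ^ 2) =O[𝓝 0] (fun r : ℝ => r ^ n) := by
    intro n hn
    rcases hn.lt_or_eq with h | rfl
    · exact (isLittleO_pow_pow h).isBigO
    · exact isBigO_refl _ _
  have ha : a = 0 := by
    have h0 : a + b * 0 + c * 0 ^ 2 = 0 :=
      key (g := fun r => a + b * r + c * r ^ 2) (n := 0) (by fun_prop)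
        ((h.trans_isBigO (hpow 0 (by norm_num))).congr_left fun r => by ring)
    linarith
  subst ha
  have hb : b = 0 := by
    simpa using key (g := fun r => b + c * r) (n := 1) (by fun_prop)
      ((h.trans_isBigO (hpow 1 (by norm_num))).congr_left fun r => by ring)
  subst hb
  have hc : c = 0 := by
    simpa using key (g := fun r => c) (n := 2) (by fun_prop) (h.congr_left fun r => by ring)
  exact ⟨rfl, rfl, hc⟩

lemma polarRadius_isBigO : polarRadius =O[𝓝 0] (fun q : ℝ × ℝ => q) := by
  refine IsBigO.of_bound 2 (Eventually.of_forall fun q => ?_)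
  rw [Real.norm_of_nonneg (polarRadius_nonneg q)]
  have h1 := norm_fst_le q
  have h2 := norm_snd_le q
  rw [Real.norm_eq_abs] at h1 h2
  have h0 := norm_nonneg q
  refine Real.sqrt_le_iff.2 ⟨by positivity, ?_⟩
  nlinarith [sq_le_sq' (by linarith [abs_nonneg q.1]) h1, sq_le_sq' (by linarith [abs_nonneg q.2]) h2,
    sq_abs q.1, sq_abs q.2]

lemma bessel_taylor_coeffs {f f' f'' : ℝ → ℝ} {k : ℝ} {m : ℕ}
    (hf : ∀ r, HasDerivAt f (f' r) r) (hf' : ∀ r, HasDerivAt f' (f'' r) r)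
    (hf'' : ContinuousAt f'' 0)
    (hODE : ∀ r, r ^ 2 * f'' r + r * f' r + (k ^ 2 * r ^ 2 - (m : ℝ) ^ 2) * f r = 0) :
    (m : ℝ) ^ 2 * f 0 = 0 ∧ (1 - (m : ℝ) ^ 2) * f' 0 = 0 ∧
      (2 - (m : ℝ) ^ 2 / 2) * f'' 0 + k ^ 2 * f 0 = 0 := by
  obtain ⟨h1, h2⟩ := hasDerivAt_taylor_isLittleO hf (hf' 0)
  have hsq : (fun r : ℝ => r ^ 2) =O[𝓝 0] (fun r : ℝ => r ^ 2) := isBigO_refl _ _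
  have t1 : (fun r => r ^ 2 * (f'' r - f'' 0)) =o[𝓝 0] (fun r : ℝ => r ^ 2) := by
    have : (fun r => f'' r - f'' 0) =o[𝓝 0] (fun _ : ℝ => (1 : ℝ)) :=
      (isLittleO_one_iff ℝ).2 (tendsto_sub_nhds_zero_iff.2 hf'')
    simpa using hsq.mul_isLittleO this
  have t2 : (fun r => r ^ 2 * (f r - f 0)) =o[𝓝 0] (fun r : ℝ => r ^ 2) := by
    have : (fun r => f r - f 0) =o[𝓝 0] (fun _ : ℝ => (1 : ℝ)) :=
      (isLittleO_one_iff ℝ).2 (tendsto_sub_nhds_zero_iff.2 (hf 0).continuousAt)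
    simpa using hsq.mul_isLittleO this
  have t3 : (fun r => r * (f' r - f' 0 - f'' 0 * r)) =o[𝓝 0] (fun r : ℝ => r ^ 2) :=
    ((isBigO_refl (fun r : ℝ => r) (𝓝 0)).mul_isLittleO h1).congr_right fun r => by ring
  have t := (((h2.const_mul_left ((m : ℝ) ^ 2)).sub t1).sub t3).sub (t2.const_mul_left (k ^ 2))
  obtain ⟨e0, e1, e2⟩ := quadratic_coeffs_eq_zero_of_isLittleO (a := -((m : ℝ) ^ 2 * f 0))
    (b := (1 - (m : ℝ) ^ 2) * f' 0) (c := (2 - (m : ℝ) ^ 2 / 2) * f'' 0 + k ^ 2 * f 0)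
    (t.congr_left fun r => by linear_combination -hODE r)
  exact ⟨neg_eq_zero.1 e0, e1, e2⟩

lemma abs_fst_le_polarRadius (q : ℝ × ℝ) : |q.1| ≤ polarRadius q :=
  Real.abs_le_sqrt (by nlinarith [sq_nonneg q.2])

lemma abs_snd_le_polarRadius (q : ℝ × ℝ) : |q.2| ≤ polarRadius q :=
  Real.abs_le_sqrt (by nlinarith [sq_nonneg q.1])

lemma hasPartials_zero_of_abs_le {v : ℝ × ℝ → ℝ} {a b : ℝ} {H : ℝ → ℝ}
    (hH : H =o[𝓝 0] (fun r : ℝ => r))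
    (hv : ∀ q, |v q - v 0 - (a * q.1 + b * q.2)| ≤ |H (polarRadius q)|) :
    HasPartials v a b 0 := by
  refine HasFDerivAt.of_isLittleO ?_
  have ht : Tendsto polarRadius (𝓝 0) (𝓝 0) := by
    simpa [polarRadius_zero] using continuous_polarRadius.tendsto 0
  have h1 := (hH.comp_tendsto ht).trans_isBigO (polarRadius_isBigO)
  refine (IsBigO.of_bound 1 (Eventually.of_forall fun q => ?_)).trans_isLittleO
    (h1.congr_right fun q => (sub_zero q).symm)
  simpa using hv q

lemma laplacian2_radial_mul_cos_zero {f f' : ℝ → ℝ} {m : ℕ} {a g α β : ℝ}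
    (hf : ∀ r, HasDerivAt f (f' r) r) (hf' : HasDerivAt f' a 0)
    (h0 : ∀ q, (f 0 + f' 0 * polarRadius q) * Real.cos (m * polarAngle q) = f 0 + g * q.1)
    (h1 : ∀ q, q ≠ 0 →
      (f' 0 + a * polarRadius q) * (q.1 / polarRadius q) * Real.cos (m * polarAngle q)
        + m * ((f 0 + f' 0 * polarRadius q + a / 2 * polarRadius q ^ 2)
          * (q.2 / polarRadius q ^ 2)) * Real.sin (m * polarAngle q) = g + α * q.1)
    (h2 : ∀ q, q ≠ 0 →
      (f' 0 + a * polarRadius q) * (q.2 / polarRadius q) * Real.cos (m * polarAngle q)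
        - m * ((f 0 + f' 0 * polarRadius q + a / 2 * polarRadius q ^ 2)
          * (q.1 / polarRadius q ^ 2)) * Real.sin (m * polarAngle q) = β * q.2) :
    laplacian2 (fun q => f (polarRadius q) * Real.cos (m * polarAngle q)) 0 = α + β := by
  set u : ℝ × ℝ → ℝ := fun q => f (polarRadius q) * Real.cos (m * polarAngle q) with hu
  obtain ⟨t1, t2⟩ := hasDerivAt_taylor_isLittleO hf hf'
  set E₁ : ℝ → ℝ := fun r => f' r - f' 0 - a * r with hE₁
  set E : ℝ → ℝ := fun r => f r - f 0 - f' 0 * r - a / 2 * r ^ 2 with hE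
  have hu0 : HasPartials u g 0 0 := by
    have hd : (fun r => f r - f 0 - f' 0 * r) =o[𝓝 0] (fun r : ℝ => r) := by
      simpa [mul_comm (f' 0)] using (hf 0).isLittleO
    refine hasPartials_zero_of_abs_le hd fun q => ?_
    have : u q - u 0 - (g * q.1 + 0 * q.2) =
        (f (polarRadius q) - f 0 - f' 0 * polarRadius q) * Real.cos (m * polarAngle q) := by
      simp only [hu, polarRadius_zero, polarAngle_zero, mul_zero, Real.cos_zero]
      linear_combination h0 q
    rw [this, abs_mul]
    exact mul_le_of_le_one_right (abs_nonneg _) (Real.abs_cos_le_one _)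
  have hH : (fun r => |E₁ r| + m * |E r * r⁻¹|) =o[𝓝 0] (fun r : ℝ => r) := by
    refine t1.abs_left.add (IsLittleO.const_mul_left (IsLittleO.abs_left ?_) _)
    refine (t2.mul_isBigO (isBigO_refl (fun r : ℝ => r⁻¹) _)).congr_right fun r => ?_
    rcases eq_or_ne r 0 with rfl | hr
    · simp
    · field_simp
  have bound : ∀ q : ℝ × ℝ, q ≠ 0 → ∀ x y : ℝ, |x| ≤ polarRadius q → |y| ≤ polarRadius q →
      |E₁ (polarRadius q) * (x / polarRadius q) * Real.cos (m * polarAngle q)|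
        + |m * (E (polarRadius q) * (y / polarRadius q ^ 2)) * Real.sin (m * polarAngle q)|
      ≤ |(|E₁ (polarRadius q)| + m * |E (polarRadius q) * (polarRadius q)⁻¹|)| := by
    intro q hq x y hx hy
    have hr := polarRadius_pos hq
    refine le_trans (add_le_add ?_ ?_) (le_abs_self _)
    · rw [mul_assoc, abs_mul, abs_mul, abs_div, abs_of_pos hr]
      refine mul_le_of_le_one_right (abs_nonneg _) (mul_le_one₀ ?_ (abs_nonneg _)
        (Real.abs_cos_le_one _))
      rwa [div_le_one hr]
    · have : (m : ℝ) * (E (polarRadius q) * (y / polarRadius q ^ 2)) * Real.sin (m * polarAngle q)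
          = m * (E (polarRadius q) * (polarRadius q)⁻¹ *
            (y / polarRadius q * Real.sin (m * polarAngle q))) := by
        field_simp
      rw [this, abs_mul, Nat.abs_cast, abs_mul (E (polarRadius q) * (polarRadius q)⁻¹)]
      gcongr
      refine mul_le_of_le_one_right (abs_nonneg _) ?_
      rw [abs_mul, abs_div, abs_of_pos hr]
      exact mul_le_one₀ (by rwa [div_le_one hr]) (abs_nonneg _) (Real.abs_sin_le_one _)
  have H1 : HasPartials (fun q => fderiv ℝ u q ((1 : ℝ), (0 : ℝ))) α 0 0 := by
    refine hasPartials_zero_of_abs_le hH fun q => ?_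
    rcases eq_or_ne q 0 with rfl | hq
    · simp
    refine le_trans ?_ (bound q hq q.1 q.2 (abs_fst_le_polarRadius q) (abs_snd_le_polarRadius q))
    refine le_trans (le_of_eq (congrArg abs ?_)) (abs_add_le _ _)
    rw [hu0.fderiv_fst, (hasPartials_radial_mul_cos m hq (hf _)).fderiv_fst]
    linear_combination h1 q hq
  have H2 : HasPartials (fun q => fderiv ℝ u q ((0 : ℝ), (1 : ℝ))) 0 β 0 := by
    refine hasPartials_zero_of_abs_le hH fun q => ?_
    rcases eq_or_ne q 0 with rfl | hq
    · simp
    refine le_trans ?_ (bound q hq q.2 q.1 (abs_snd_le_polarRadius q) (abs_fst_le_polarRadius q))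
    refine le_trans (le_of_eq (congrArg abs ?_)) (abs_sub _ _)
    rw [hu0.fderiv_snd, (hasPartials_radial_mul_cos m hq (hf _)).fderiv_snd]
    linear_combination h2 q hq
  rw [laplacian2, H1.fderiv_fst, H2.fderiv_snd]

end Origin

lemma bessel_mode_helmholtz_zero {f f' f'' : ℝ → ℝ} {k : ℝ} {m : ℕ}
    (hf : ∀ r, HasDerivAt f (f' r) r) (hf' : ∀ r, HasDerivAt f' (f'' r) r)
    (hf'' : ContinuousAt f'' 0)
    (hODE : ∀ r, r ^ 2 * f'' r + r * f' r + (k ^ 2 * r ^ 2 - (m : ℝ) ^ 2) * f r = 0) :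
    laplacian2 (fun q => f (polarRadius q) * Real.cos (m * polarAngle q)) 0
      + k ^ 2 * f 0 = 0 := by
  obtain ⟨e0, e1, e2⟩ := bessel_taylor_coeffs hf hf' hf'' hODE
  match m, e0, e1, e2 with
  | 0, e0, e1, e2 =>
    norm_num at e1 e2
    rw [laplacian2_radial_mul_cos_zero (a := f'' 0) (g := 0) (α := f'' 0) (β := f'' 0) hf (hf' 0)]
    · linarith
    · simp [e1]
    all_goals
      intro q hq
      have hr := polarRadius_pos hq
      simp [e1]
      field_simp
  | 1, e0, e1, e2 =>
    norm_num at e0 e2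
    have e3 : f'' 0 = 0 := by rw [e0] at e2; linarith
    rw [laplacian2_radial_mul_cos_zero (a := f'' 0) (g := f' 0) (α := 0) (β := 0) hf (hf' 0)]
    · simp [e0]
    · intro q
      rcases eq_or_ne q 0 with rfl | hq
      · simp [polarRadius_zero, e0]
      have hr := polarRadius_pos hq
      simp [e0, cos_polarAngle hq]
      field_simp
    · intro q hq
      have hr := polarRadius_pos hq
      simp only [e0, e3, cos_polarAngle hq, sin_polarAngle, Nat.cast_one, one_mul]
      field_simp
      linear_combination (-2 * polarRadius q * f' 0) * polarRadius_sq q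
    · intro q hq
      have hr := polarRadius_pos hq
      simp only [e0, e3, cos_polarAngle hq, sin_polarAngle, Nat.cast_one, one_mul]
      field_simp
      ring
  | 2, e0, e1, e2 =>
    norm_num at e0 e1
    rw [laplacian2_radial_mul_cos_zero (a := f'' 0) (g := 0) (α := f'' 0) (β := -f'' 0) hf (hf' 0)]
    · simp [e0]
    · simp [e0, e1]
    all_goals
      intro q hq
      have hr := polarRadius_pos hq
      have e := polarRadius_sq q
      simp only [e0, e1, Nat.cast_ofNat, Real.cos_two_mul', Real.sin_two_mul, cos_polarAngle hq,
        sin_polarAngle]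
      field_simp
      ring_nf
      simp only [e, show polarRadius q ^ 4 = (polarRadius q ^ 2) ^ 2 by ring]
      ring
  | n + 3, e0, e1, e2 =>
    have hn : (3 : ℝ) ≤ (n + 3 : ℕ) := by push_cast; linarith [Nat.cast_nonneg (α := ℝ) n]
    have hn2 : (9 : ℝ) ≤ ((n + 3 : ℕ) : ℝ) ^ 2 := by nlinarith
    have h0 : f 0 = 0 := (mul_eq_zero.1 e0).resolve_left (by linarith)
    have h1 : f' 0 = 0 := (mul_eq_zero.1 e1).resolve_left (by linarith)
    rw [h0, mul_zero, add_zero] at e2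
    have h2 : f'' 0 = 0 := (mul_eq_zero.1 e2).resolve_left (by linarith)
    rw [laplacian2_radial_mul_cos_zero (a := f'' 0) (g := 0) (α := 0) (β := 0) hf (hf' 0)] <;>
      simp [h0, h1, h2]

/-- If `J` is a (twice continuously differentiable) solution of the Bessel ODE of
order `m` and `χ > 0` is a zero of `J`, then `u(r,θ) = J(rχ/R) cos(mθ)`, in Cartesian
coordinates `r = √(y²+z²)`, `θ = atan2(z,y)`, satisfies `Δu + (χ/R)² u = 0` in the
open disk of radius `R` and vanishes on the boundary circle `r = R`. -/
theorem bessel_mode_helmholtz (m : ℕ) (R χ : ℝ) (hR : 0 < R) (hχ : 0 < χ)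
    (J : ℝ → ℝ) (hJ : ContDiff ℝ 2 J)
    (hODE : ∀ r : ℝ, r ^ 2 * deriv (deriv J) r + r * deriv J r
      + (r ^ 2 - (m : ℝ) ^ 2) * J r = 0)
    (hroot : J χ = 0) :
    (∀ p : ℝ × ℝ, p.1 ^ 2 + p.2 ^ 2 < R ^ 2 →
      laplacian2 (fun q => J (Real.sqrt (q.1 ^ 2 + q.2 ^ 2) * χ / R) *
          Real.cos (m * Complex.arg (q.1 + q.2 * Complex.I))) p
        + (χ / R) ^ 2 * (J (Real.sqrt (p.1 ^ 2 + p.2 ^ 2) * χ / R) *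
          Real.cos (m * Complex.arg (p.1 + p.2 * Complex.I))) = 0) ∧
    (∀ p : ℝ × ℝ, p.1 ^ 2 + p.2 ^ 2 = R ^ 2 →
      J (Real.sqrt (p.1 ^ 2 + p.2 ^ 2) * χ / R) *
          Real.cos (m * Complex.arg (p.1 + p.2 * Complex.I)) = 0) := by
  set k : ℝ := χ / R with hk
  have hJ1 : ContDiff ℝ 1 (deriv J) := hJ.deriv'
  have dJ : ∀ r, HasDerivAt J (deriv J r) r := fun r =>
    (hJ.differentiable two_ne_zero r).hasDerivAt
  have dJ' : ∀ r, HasDerivAt (deriv J) (deriv (deriv J) r) r := fun r =>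
    (hJ1.differentiable one_ne_zero r).hasDerivAt
  have cJ : Continuous (deriv (deriv J)) := hJ1.continuous_deriv le_rfl
  have hlin : ∀ r : ℝ, HasDerivAt (fun r => r * χ / R) k r := fun r => by
    simpa [hk, mul_div_assoc] using (hasDerivAt_id r).mul_const (χ / R)
  have hf : ∀ r, HasDerivAt (fun r => J (r * χ / R)) (k * deriv J (r * χ / R)) r := fun r =>
    ((dJ _).comp r (hlin r)).congr_deriv (mul_comm _ _)
  have hf' : ∀ r, HasDerivAt (fun r => k * deriv J (r * χ / R))
      (k ^ 2 * deriv (deriv J) (r * χ / R)) r := fun r =>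
    (((dJ' _).comp r (hlin r)).const_mul k).congr_deriv (by ring)
  have hODE' : ∀ r : ℝ, r ^ 2 * (k ^ 2 * deriv (deriv J) (r * χ / R))
      + r * (k * deriv J (r * χ / R)) + (k ^ 2 * r ^ 2 - (m : ℝ) ^ 2) * J (r * χ / R) = 0 := by
    intro r
    have h := hODE (r * χ / R)
    have e : r * χ / R = r * k := by rw [hk]; ring
    rw [e] at h ⊢
    linear_combination h
  refine ⟨fun p _ => ?_, fun p hp => ?_⟩
  · change laplacian2 (fun q => J (polarRadius q * χ / R) * Real.cos (m * polarAngle q)) p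
      + k ^ 2 * (J (polarRadius p * χ / R) * Real.cos (m * polarAngle p)) = 0
    rcases eq_or_ne p 0 with rfl | hp
    · have h := bessel_mode_helmholtz_zero hf hf' (by fun_prop) hODE'
      simpa [polarRadius_zero, polarAngle_zero] using h
    · have hr := polarRadius_pos hp
      rw [laplacian2_radial_mul_cos m hf hf' hp]
      linear_combination (norm := (field_simp; ring))
        Real.cos (m * polarAngle p) / polarRadius p ^ 2 * hODE' (polarRadius p)
  · rw [hp, Real.sqrt_sq hR.le, mul_div_assoc, mul_div_cancel₀ _ hR.ne', hroot, zero_mul]
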